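/- Assume ρ : [0,∞) → ℝ is C², non-increasing, with ρ(r) > 0 for 0 ≤ r < R and ρ(r) = 0 for r ≥ R, and let v be the continuous solution of the Riccati equation v′(r) = (5/r)·v(r)(1 − v(r)) + (3/5)·ρ′(r)/ρ̄(r) on (0,R] with v(0) = 1. Define for 0 < s ≤ R: f(s) = ρ(s)/ρ̄(s), β(s)² = (5/3)·(∫₀^s a⁴ρ(a) da)/(s²·∫₀^s a²ρ(a) da), z(s) = v(s) − (3/5)·f(s), and Γ(s) = (3/2)·β(s)⁵·z(s)/(1 − z(s)). Then: (i) z extends continuously with z(0) = 2/5 and satisfies z′(r) = (5/r)·z(1 − z) + (6/5)·(f(r)/r)·(1 − 5z) for 0 < r ≤ R; (ii) (β²)′(s) = (1/s)·(−(3f(s)+2)·β(s)² + 5f(s)); and (iii) Γ extends continuously with Γ(0) = 1 and satisfies Γ′(s) = (f(s)/(10·s·β(s)⁵))·( 18·β(s)¹⁰ + (125·β(s)³ − 111·β(s)⁵)·Γ(s) − 32·Γ(s)² ) for 0 < s ≤ R. -/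

import Mathlib

open MeasureTheory Set Real Filter

/-- The mean density inside radius `r`: `ρ̄(r) = (3/r³)∫₀^r a²ρ(a) da`, with `ρ̄(0) = ρ(0)`. -/
noncomputable def rhoBar (ρ : ℝ → ℝ) (r : ℝ) : ℝ :=
  if r = 0 then ρ 0 else (3 / r ^ 3) * ∫ a in (0:ℝ)..r, a ^ 2 * ρ a

/-- For `g` antitone on `[0,∞)`, the moment `∫₀^s aⁿ g(a) da` lies between the values obtained by
freezing `g` at the endpoints, so its normalisation by `s^(n+1)` tends to `g 0 / (n + 1)`. -/
lemma tendsto_moment_div_pow {g : ℝ → ℝ} (hg : Continuous g) (hmono : AntitoneOn g (Ici 0))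
    (n : ℕ) :
    Tendsto (fun s : ℝ => (∫ a in (0:ℝ)..s, a ^ n * g a) / s ^ (n + 1))
      (nhdsWithin 0 (Ioi 0)) (nhds (g 0 / (n + 1))) := by
  have hlow : Tendsto (fun s : ℝ => g s / (n + 1)) (nhdsWithin 0 (Ioi 0))
      (nhds (g 0 / (n + 1))) :=
    ((hg.tendsto 0).mono_left nhdsWithin_le_nhds).div_const _
  have hint (c s : ℝ) :
      ∫ a in (0:ℝ)..s, a ^ n * c = c / (n + 1) * s ^ (n + 1) := by
    rw [intervalIntegral.integral_mul_const, integral_pow]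
    simp
    ring
  refine tendsto_of_tendsto_of_tendsto_of_le_of_le' hlow tendsto_const_nhds ?_ ?_
  · filter_upwards [self_mem_nhdsWithin] with s hs
    have hs : 0 < s := hs
    rw [le_div_iff₀ (by positivity), ← hint]
    refine intervalIntegral.integral_mono_on hs.le
      (Continuous.intervalIntegrable (by fun_prop) _ _)
      (Continuous.intervalIntegrable (by fun_prop) _ _) fun a ha => ?_
    exact mul_le_mul_of_nonneg_left (hmono ha.1 hs.le ha.2) (pow_nonneg ha.1 n)
  · filter_upwards [self_mem_nhdsWithin] with s hs
    have hs : 0 < s := hs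
    rw [div_le_iff₀ (by positivity), ← hint]
    refine intervalIntegral.integral_mono_on hs.le
      (Continuous.intervalIntegrable (by fun_prop) _ _)
      (Continuous.intervalIntegrable (by fun_prop) _ _) fun a ha => ?_
    exact mul_le_mul_of_nonneg_left (hmono self_mem_Ici ha.1 ha.1) (pow_nonneg ha.1 n)

lemma hasDerivAt_moment {g : ℝ → ℝ} (hg : Continuous g) (n : ℕ) (s : ℝ) :
    HasDerivAt (fun s : ℝ => ∫ a in (0:ℝ)..s, a ^ n * g a) (s ^ n * g s) s := by
  have hc : Continuous fun a : ℝ => a ^ n * g a := by fun_prop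
  exact intervalIntegral.integral_hasDerivAt_right (hc.intervalIntegrable _ _)
    hc.stronglyMeasurable.stronglyMeasurableAtFilter hc.continuousAt

lemma moment_pos {g : ℝ → ℝ} (hg : Continuous g) {R : ℝ}
    (hpos : ∀ r : ℝ, 0 ≤ r → r < R → 0 < g r) (n : ℕ) {s : ℝ} (hs : s ∈ Ioc 0 R) :
    0 < ∫ a in (0:ℝ)..s, a ^ n * g a := by
  refine intervalIntegral.intervalIntegral_pos_of_pos_on
    (Continuous.intervalIntegrable (by fun_prop) _ _) (fun a ha => ?_) hs.1
  exact mul_pos (pow_pos ha.1 n) (hpos a ha.1.le (ha.2.trans_le hs.2))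

lemma rhoBar_of_pos (ρ : ℝ → ℝ) {r : ℝ} (hr : 0 < r) :
    rhoBar ρ r = 3 / r ^ 3 * ∫ a in (0:ℝ)..r, a ^ 2 * ρ a :=
  if_neg hr.ne'

lemma hasDerivAt_rhoBar {ρ : ℝ → ℝ} (hρ : Continuous ρ) {r : ℝ} (hr : 0 < r) :
    HasDerivAt (rhoBar ρ) (3 / r * (ρ r - rhoBar ρ r)) r := by
  have hquot := ((hasDerivAt_moment hρ 2 r).const_mul 3).div (hasDerivAt_pow 3 r)
    (pow_pos hr 3).ne'
  have heq : rhoBar ρ =ᶠ[nhds r]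
      fun s => 3 * (∫ a in (0:ℝ)..s, a ^ 2 * ρ a) / s ^ 3 := by
    filter_upwards [Ioi_mem_nhds hr] with s hs
    rw [rhoBar_of_pos ρ hs]
    ring
  refine (hquot.congr_of_eventuallyEq heq).congr_deriv ?_
  rw [rhoBar_of_pos ρ hr]
  field_simp
  ring

lemma tendsto_rhoBar {ρ : ℝ → ℝ} (hρ : Continuous ρ) (hmono : AntitoneOn ρ (Ici 0)) :
    Tendsto (rhoBar ρ) (nhdsWithin 0 (Ioi 0)) (nhds (ρ 0)) := by
  have h := (tendsto_moment_div_pow hρ hmono 2).const_mul 3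
  have hlim : 3 * (ρ 0 / ((2 : ℕ) + 1)) = ρ 0 := by push_cast; ring
  rw [hlim] at h
  refine h.congr' ?_
  filter_upwards [self_mem_nhdsWithin] with s hs
  rw [rhoBar_of_pos ρ hs]
  ring

lemma tendsto_betaSq {ρ : ℝ → ℝ} (hρ : Continuous ρ) (hmono : AntitoneOn ρ (Ici 0))
    (h0 : 0 < ρ 0) :
    Tendsto (fun s : ℝ => (5 / 3) * (∫ a in (0:ℝ)..s, a ^ 4 * ρ a) /
      (s ^ 2 * ∫ a in (0:ℝ)..s, a ^ 2 * ρ a)) (nhdsWithin 0 (Ioi 0)) (nhds 1) := by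
  have h := ((tendsto_moment_div_pow hρ hmono 4).const_mul (5 / 3)).div
    (tendsto_moment_div_pow hρ hmono 2) (by positivity)
  have hlim : 5 / 3 * (ρ 0 / ((4 : ℕ) + 1)) / (ρ 0 / ((2 : ℕ) + 1)) = 1 := by
    push_cast; field_simp; norm_num
  rw [hlim] at h
  refine h.congr' ?_
  filter_upwards [self_mem_nhdsWithin] with s hs
  have hs : s ≠ 0 := (show (0 : ℝ) < s from hs).ne'
  simp only [Pi.div_apply]
  by_cases hM : ∫ a in (0:ℝ)..s, a ^ 2 * ρ a = 0
  · simp [hM]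
  · field_simp
    ring

/-- If `z < 1` at `ε` and `1 - z` satisfies `(1 - z)' ≥ -A (1 - z)` wherever `z < 1`, with `A`
bounded above, then `z` stays below `1`. -/
lemma lt_one_of_linear_barrier {z z' : ℝ → ℝ} {ε R K : ℝ}
    (hderiv : ∀ r ∈ Icc ε R, HasDerivAt z (z' r) r) (hε : z ε < 1)
    (hbound : ∀ r ∈ Icc ε R, z r < 1 → z' r < K * (1 - z r)) :
    ∀ r ∈ Icc ε R, z r < 1 := by
  intro r hr
  have hB (x : ℝ) : HasDerivAt (fun x => 1 - (1 - z ε) * Real.exp (-K * (x - ε)))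
      (K * ((1 - z ε) * Real.exp (-K * (x - ε)))) x := by
    have h := (((((hasDerivAt_id x).sub_const ε).const_mul (-K)).exp).const_mul
      (1 - z ε)).const_sub 1
    refine h.congr_deriv ?_
    simp only [id]
    ring
  have hpos (x : ℝ) : 0 < (1 - z ε) * Real.exp (-K * (x - ε)) :=
    mul_pos (sub_pos.2 hε) (Real.exp_pos _)
  have hle := image_le_of_deriv_right_lt_deriv_boundary'
    (f := z) (f' := z') (fun x hx => (hderiv x hx).continuousAt.continuousWithinAt)
    (fun x hx => (hderiv x ⟨hx.1, hx.2.le⟩).hasDerivWithinAt)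
    (by simp)
    (fun x _ => (hB x).continuousAt.continuousWithinAt)
    (fun x _ => (hB x).hasDerivWithinAt)
    (fun x hx hzx => by
      have hb := hbound x ⟨hx.1, hx.2.le⟩ (by linarith [hpos x])
      rwa [show 1 - z x = (1 - z ε) * Real.exp (-K * (x - ε)) by linarith] at hb) hr
  linarith [hpos r]

/-- Differential identities for `f = ρ/ρ̄`, `β² `, `z = v − (3/5)f`
and `Γ = (3/2)β⁵z/(1−z)` along the Riccati solution `v`:
(i) `z(0⁺) = 2/5` and `z′ = (5/r)z(1−z) + (6/5)(f/r)(1−5z)`;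
(ii) `(β²)′ = (1/s)(−(3f+2)β² + 5f)`;
(iii) `Γ(0⁺) = 1` and `Γ′ = (f/(10sβ⁵))(18β¹⁰ + (125β³ − 111β⁵)Γ − 32Γ²)`. -/
theorem stmt_12 (R : ℝ) (hR : 0 < R)
    (ρ : ℝ → ℝ) (hC2 : ContDiff ℝ 2 ρ) (hmono : AntitoneOn ρ (Ici 0))
    (hpos : ∀ r : ℝ, 0 ≤ r → r < R → 0 < ρ r) (hzero : ∀ r : ℝ, R ≤ r → ρ r = 0)
    (v : ℝ → ℝ) (hvcont : ContinuousOn v (Icc 0 R)) (hv0 : v 0 = 1)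
    (hvderiv : ∀ r ∈ Ioc (0:ℝ) R,
      HasDerivAt v ((5 / r) * v r * (1 - v r) + (3 / 5) * deriv ρ r / rhoBar ρ r) r)
    (f βsq z Γ : ℝ → ℝ)
    (hf : ∀ s : ℝ, f s = ρ s / rhoBar ρ s)
    (hβ : ∀ s : ℝ, βsq s =
      (5 / 3) * (∫ a in (0:ℝ)..s, a ^ 4 * ρ a) / (s ^ 2 * ∫ a in (0:ℝ)..s, a ^ 2 * ρ a))
    (hz : ∀ s : ℝ, z s = v s - (3 / 5) * f s)
    (hΓ : ∀ s : ℝ, Γ s = (3 / 2) * Real.sqrt (βsq s) ^ 5 * z s / (1 - z s)) :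
    (Tendsto z (nhdsWithin 0 (Ioi 0)) (nhds (2 / 5)) ∧
      ∀ r ∈ Ioc (0:ℝ) R,
        HasDerivAt z ((5 / r) * z r * (1 - z r) + (6 / 5) * (f r / r) * (1 - 5 * z r)) r) ∧
    (∀ s ∈ Ioc (0:ℝ) R,
      HasDerivAt βsq ((1 / s) * (-(3 * f s + 2) * βsq s + 5 * f s)) s) ∧
    (Tendsto Γ (nhdsWithin 0 (Ioi 0)) (nhds 1) ∧
      ∀ s ∈ Ioc (0:ℝ) R,
        HasDerivAt Γ ((f s / (10 * s * Real.sqrt (βsq s) ^ 5)) *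
          (18 * Real.sqrt (βsq s) ^ 10 +
            (125 * Real.sqrt (βsq s) ^ 3 - 111 * Real.sqrt (βsq s) ^ 5) * Γ s
            - 32 * Γ s ^ 2)) s) := by
  have hρ : Continuous ρ := hC2.continuous
  have hρ0 : 0 < ρ 0 := hpos 0 le_rfl hR
  have hρnn (s : ℝ) (hs : s ∈ Ioc 0 R) : 0 ≤ ρ s :=
    hs.2.lt_or_eq.elim (fun h => (hpos s hs.1.le h).le) fun h => (hzero s h.ge).ge
  have hM (s : ℝ) (hs : s ∈ Ioc 0 R) : 0 < ∫ a in (0:ℝ)..s, a ^ 2 * ρ a :=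
    moment_pos hρ hpos 2 hs
  have hbar (s : ℝ) (hs : s ∈ Ioc 0 R) : 0 < rhoBar ρ s := by
    rw [rhoBar_of_pos ρ hs.1]
    exact mul_pos (div_pos three_pos (pow_pos hs.1 3)) (hM s hs)
  have hfnn (s : ℝ) (hs : s ∈ Ioc 0 R) : 0 ≤ f s := by
    rw [hf]
    exact div_nonneg (hρnn s hs) (hbar s hs).le
  have hf' (s : ℝ) (hs : s ∈ Ioc 0 R) :
      HasDerivAt f (deriv ρ s / rhoBar ρ s - 3 / s * f s * (f s - 1)) s := by
    have hd := (hC2.differentiable (by norm_num) s).hasDerivAt.div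
      (hasDerivAt_rhoBar hρ hs.1) (hbar s hs).ne'
    rw [show f = ρ / rhoBar ρ from funext hf]
    refine hd.congr_deriv ?_
    have h1 := (hbar s hs).ne'
    have h2 := hs.1.ne'
    simp only [Pi.div_apply]
    field_simp
  have hz' (r : ℝ) (hr : r ∈ Ioc 0 R) :
      HasDerivAt z ((5 / r) * z r * (1 - z r) + (6 / 5) * (f r / r) * (1 - 5 * z r)) r := by
    rw [show z = fun s => v s - (3 / 5) * f s from funext hz]
    refine ((hvderiv r hr).sub ((hf' r hr).const_mul (3 / 5))).congr_deriv ?_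
    ring
  have hβ' (s : ℝ) (hs : s ∈ Ioc 0 R) :
      HasDerivAt βsq ((1 / s) * (-(3 * f s + 2) * βsq s + 5 * f s)) s := by
    have h1 := (hM s hs).ne'
    have h2 := hs.1.ne'
    have hd := ((hasDerivAt_moment hρ 4 s).const_mul (5 / 3)).div
      ((hasDerivAt_pow 2 s).mul (hasDerivAt_moment hρ 2 s)) (mul_ne_zero (pow_ne_zero 2 h2) h1)
    refine (hd.congr_of_eventuallyEq (Eventually.of_forall hβ)).congr_deriv ?_
    simp only [hf, hβ, rhoBar_of_pos ρ hs.1, Pi.mul_apply]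
    field_simp
    ring
  have hβpos (s : ℝ) (hs : s ∈ Ioc 0 R) : 0 < βsq s := by
    rw [hβ]
    have := moment_pos hρ hpos 4 hs
    have := hM s hs
    have := hs.1
    positivity
  have hflim : Tendsto f (nhdsWithin 0 (Ioi 0)) (nhds 1) := by
    have h := ((hρ.tendsto 0).mono_left nhdsWithin_le_nhds).div (tendsto_rhoBar hρ hmono) hρ0.ne'
    rw [div_self hρ0.ne'] at h
    exact h.congr fun s => (hf s).symm
  have hvlim : Tendsto v (nhdsWithin 0 (Ioi 0)) (nhds 1) := by
    have h := hvcont 0 ⟨le_rfl, hR.le⟩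
    rw [ContinuousWithinAt, hv0] at h
    refine h.mono_left (nhdsWithin_le_of_mem ?_)
    exact mem_of_superset (Ioc_mem_nhdsGT hR) Ioc_subset_Icc_self
  have hzlim : Tendsto z (nhdsWithin 0 (Ioi 0)) (nhds (2 / 5)) := by
    have h := hvlim.sub (hflim.const_mul (3 / 5))
    rw [show (1 : ℝ) - 3 / 5 * 1 = 2 / 5 by norm_num] at h
    exact h.congr fun s => (hz s).symm
  have hβlim : Tendsto βsq (nhdsWithin 0 (Ioi 0)) (nhds 1) :=
    (tendsto_betaSq hρ hmono hρ0).congr fun s => (hβ s).symm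
  have hz1 (s : ℝ) (hs : s ∈ Ioc 0 R) : z s < 1 := by
    obtain ⟨ε, hzε, hε⟩ := ((hzlim.eventually_lt_const (by norm_num : (2 / 5 : ℝ) < 1)).and
      (Ioc_mem_nhdsGT hs.1)).exists
    have hsub : Icc ε R ⊆ Ioc 0 R := fun r hr => ⟨hε.1.trans_le hr.1, hr.2⟩
    have hcont : ContinuousOn (fun r => (5 * z r + 6 * f r) / r) (Icc ε R) := fun r hr =>
      (((hz' r (hsub hr)).continuousAt.const_mul 5).add
        ((hf' r (hsub hr)).continuousAt.const_mul 6)).div continuousAt_id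
          (hsub hr).1.ne' |>.continuousWithinAt
    obtain ⟨K, hK⟩ := isCompact_Icc.bddAbove_image hcont
    refine lt_one_of_linear_barrier (K := K + 1) (fun r hr => hz' r (hsub hr)) hzε
      (fun r hr hzr => ?_) s ⟨hε.2, hs.2⟩
    have hA : (5 * z r + 6 * f r) / r ≤ K := hK (mem_image_of_mem _ hr)
    have hB : 0 ≤ f r / r := div_nonneg (hfnn r (hsub hr)) (hsub hr).1.le
    have hsplit : 5 / r * z r * (1 - z r) + 6 / 5 * (f r / r) * (1 - 5 * z r) =
        (5 * z r + 6 * f r) / r * (1 - z r) - 24 / 5 * (f r / r) := by ring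
    rw [hsplit]
    nlinarith [mul_le_mul_of_nonneg_right hA (sub_pos.2 hzr).le]
  refine ⟨⟨hzlim, hz'⟩, hβ', ?_, fun s hs => ?_⟩
  · have h := (((hβlim.sqrt.pow 5).const_mul (3 / 2)).mul hzlim).div
      (hzlim.const_sub 1) (by norm_num)
    rw [show (3 / 2 * √1 ^ 5 * (2 / 5) / (1 - 2 / 5) : ℝ) = 1 by norm_num] at h
    exact h.congr fun s => (hΓ s).symm
  · have hb := (hβ' s hs).sqrt (hβpos s hs).ne'
    have hz1s : 1 - z s ≠ 0 := (sub_pos.2 (hz1 s hs)).ne'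
    have hd := (((hb.pow 5).const_mul (3 / 2)).mul (hz' s hs)).div
      ((hz' s hs).const_sub 1) hz1s
    refine (hd.congr_of_eventuallyEq (Eventually.of_forall hΓ)).congr_deriv ?_
    have hsq : βsq s = √(βsq s) ^ 2 := (Real.sq_sqrt (hβpos s hs).le).symm
    have hbne : √(βsq s) ≠ 0 := (Real.sqrt_pos.2 (hβpos s hs)).ne'
    have hs0 := hs.1.ne'
    simp only [hΓ, Pi.mul_apply, Pi.pow_apply]
    generalize √(βsq s) = b at *
    rw [hsq]
    field_simp
    ring
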